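/- arXiv:1309.5215 — 7 statements merged into one kernel-verified Lean document; each statement's English description precedes it below -/
import Mathlib

section
/- Let H be a finite group and let C₁, C₂, C₃ be conjugacy classes in H, with chosen representatives x₁ ∈ C₁, x₂ ∈ C₂, x₃ ∈ C₃. Then the number of triples (y₁, y₂, y₃) ∈ C₁ × C₂ × C₃ with y₁y₂y₃ = 1 equals (|C₁||C₂||C₃|/|H|) · Σ_χ χ(x₁)χ(x₂)χ(x₃)/χ(1), where the sum ranges over all irreducible complex characters χ of H (the equality being between the natural number cast into ℂ and the complex-valued expression). -/
open CategoryTheory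

lemma fr_dim_ne {H : Type} [Group H] [Fintype H] (V : FDRep ℂ H) [Simple V] :
    (V.character 1) ≠ 0 := by
  intro h
  rw [FDRep.char_one, Nat.cast_eq_zero] at h
  have hs : Subsingleton V := Module.finrank_zero_iff.mp h
  have h0 : ∀ g, V.character g = 0 := by
    intro g
    have : V.ρ g = 0 := Subsingleton.elim _ _
    simp [FDRep.character, this]
  have := (FDRep.simple_iff_char_is_norm_one V).1 inferInstance
  simp [h0] at this
  exact Fintype.card_ne_zero (Nat.cast_eq_zero.1 this.symm)

lemma fr_schur {H : Type} [Group H] [Fintype H] (V : FDRep ℂ H) [Simple V]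
    (f : V →ₗ[ℂ] V) (hf : ∀ g, f * V.ρ g = V.ρ g * f) :
    f = (LinearMap.trace ℂ V f / V.character 1) • (1 : V →ₗ[ℂ] V) := by
  have h1 := finrank_endomorphism_simple_eq_one ℂ V
  obtain ⟨c, hc⟩ : ∃ c : ℂ, f = c • (1 : V →ₗ[ℂ] V) := by
    let F : V ⟶ V := ⟨InducedCategory.homMk (ModuleCat.ofHom f), fun g => by
      ext x
      exact LinearMap.congr_fun (hf g) x⟩
    obtain ⟨c, hc⟩ := (finrank_eq_one_iff_of_nonzero' (𝟙 V) (id_nonzero V)).1 h1 F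
    refine ⟨c, ?_⟩
    have : F.hom.hom.hom = (c • 𝟙 V : V ⟶ V).hom.hom.hom := by rw [hc]
    exact this
  have hd := fr_dim_ne V
  have : LinearMap.trace ℂ V f / V.character 1 = c := by
    rw [div_eq_iff hd, hc, map_smul, FDRep.char_one, LinearMap.trace_one, smul_eq_mul]
  rw [this, ← hc]

lemma fr_class {H : Type} [Group H] [Fintype H] (V : FDRep ℂ H) [Simple V]
    (f : H → ℂ) (hf : ∀ g h, f (h * g * h⁻¹) = f g) :
    ∑ g, f g • V.ρ g = ((∑ g, f g * V.character g) / V.character 1) • (1 : V →ₗ[ℂ] V) := by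
  have := fr_schur V (∑ g, f g • V.ρ g) (by
    intro h
    rw [Finset.sum_mul, Finset.mul_sum]
    refine Fintype.sum_equiv (MulAut.conj h⁻¹).toEquiv _ _ fun g => ?_
    have := hf g h⁻¹
    rw [inv_inv] at this
    rw [mul_assoc] at this
    simp [this, ← map_mul, mul_assoc])
  rw [this, map_sum]
  simp [FDRep.character]

lemma fr_conj {H : Type} [Group H] [Fintype H] (V : FDRep ℂ H) [Simple V] (x : H)
    [DecidablePred (fun y => IsConj x y)] :
    ∑ g, (if IsConj x g then (1 : ℂ) else 0) • V.ρ g =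
      (({y | IsConj x y}.ncard : ℂ) * V.character x / V.character 1) • (1 : V →ₗ[ℂ] V) := by
  rw [fr_class V (fun g => if IsConj x g then (1 : ℂ) else 0)]
  · congr 2
    have : ∀ g, (if IsConj x g then (1 : ℂ) else 0) * V.character g =
        (if IsConj x g then (1 : ℂ) else 0) * V.character x := by
      intro g
      split_ifs with h
      · obtain ⟨c, rfl⟩ := isConj_iff.1 h
        rw [FDRep.char_conj]
      · simp
    simp only [this, ← Finset.sum_mul]
    congr 1
    rw [Finset.sum_boole, Set.ncard_eq_toFinset_card']
    simp
  · intro g h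
    have : IsConj x (h * g * h⁻¹) ↔ IsConj x g := by
      have hg : IsConj g (h * g * h⁻¹) := isConj_iff.2 ⟨h, rfl⟩
      exact ⟨fun k => k.trans hg.symm, fun k => k.trans hg⟩
    simp only [this]

lemma fr_simple {H : Type} [Group H] [Fintype H] (N : Submodule (MonoidAlgebra ℂ H) (MonoidAlgebra ℂ H))
    [IsSimpleModule (MonoidAlgebra ℂ H) N] [Module.Finite ℂ N] :
    Simple (FDRep.of (Representation.ofModule' (k := ℂ) (G := H) N)) := by
  rw [FDRep.simple_iff_end_is_rank_one]
  set W := FDRep.of (Representation.ofModule' (k := ℂ) (G := H) N) with hW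
  have hNt : Nontrivial N := IsSimpleModule.nontrivial (MonoidAlgebra ℂ H) N
  refine finrank_eq_one (𝟙 W) ?_ ?_
  · intro h
    obtain ⟨v, hv⟩ := exists_ne (0 : N)
    have h2 : (𝟙 W : W ⟶ W).hom.hom.hom = (0 : W ⟶ W).hom.hom.hom := by rw [h]
    exact hv (LinearMap.congr_fun h2 v)
  · intro F
    let f : N →ₗ[ℂ] N := F.hom.hom.hom
    have hf : ∀ (g : H) (v : N), f (MonoidAlgebra.single g (1:ℂ) • v)
        = MonoidAlgebra.single g (1:ℂ) • f v := by
      intro g v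
      have h3 := congrArg (fun t => t.hom.hom) (F.comm g)
      exact LinearMap.congr_fun h3 v
    let f' : N →ₗ[MonoidAlgebra ℂ H] N := MonoidAlgebra.equivariantOfLinearOfComm f hf
    obtain ⟨c, hc⟩ := (IsSimpleModule.algebraMap_end_bijective_of_isAlgClosed (A := MonoidAlgebra ℂ H) (V := N) ℂ).2 f'
    refine ⟨c, ?_⟩
    have h5 : (c • 𝟙 W : W ⟶ W).hom.hom.hom = F.hom.hom.hom := by
      refine LinearMap.ext fun v => ?_
      exact LinearMap.congr_fun hc v
    ext v : 3
    exact LinearMap.congr_fun h5 v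

lemma fr_regular {H : Type} [Group H] [Fintype H] [DecidableEq H]
    (ι : Type) [Fintype ι] (V : ι → FDRep ℂ H)
    (hirr : ∀ i, Simple (V i))
    (hcomplete : ∀ W : FDRep ℂ H, Simple W → ∃! i : ι, Nonempty (W ≅ V i)) (x : H) :
    ∑ i, (V i).character 1 * (V i).character x = if x = 1 then (Fintype.card H : ℂ) else 0 := by
  classical
  let f : H → ℂ := fun g => (if g = 1 then (Fintype.card H : ℂ) else 0) -
    ∑ i, (V i).character 1 * (V i).character g⁻¹
  have hcl : ∀ g h, f (h * g * h⁻¹) = f g := by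
    intro g h
    have e : (h * g * h⁻¹)⁻¹ = h * g⁻¹ * h⁻¹ := by group
    simp only [f, e, FDRep.char_conj, conj_eq_one_iff]
  have hinv : Invertible (Nat.card H : ℂ) := invertibleOfNonzero (NeZero.ne _)
  have hne : (Nat.card H : ℂ) ≠ 0 := NeZero.ne _
  have horth : ∀ i j, ∑ g, (V j).character g * (V i).character g⁻¹ =
      if i = j then (Fintype.card H : ℂ) else 0 := by
    intro i j
    have h1 := FDRep.char_orthonormal (V j) (V i)
    have h2 : Nonempty (V j ≅ V i) ↔ i = j := by
      constructor
      · intro h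
        exact (hcomplete (V j) (hirr j)).unique h ⟨Iso.refl _⟩
      · rintro rfl; exact ⟨Iso.refl _⟩
    rw [inv_mul_eq_iff_eq_mul₀ hne] at h1
    rw [h1]
    simp [h2]
  have htr : ∀ j, ∑ g, f g • (V j).ρ g = 0 := by
    intro j
    rw [fr_class (V j) f hcl]
    have : ∑ g, f g * (V j).character g = 0 := by
      simp only [f, sub_mul, Finset.sum_sub_distrib, Finset.sum_mul]
      rw [Finset.sum_comm]
      have : ∀ i, ∑ g, (V i).character 1 * (V i).character g⁻¹ * (V j).character g =
        (V i).character 1 * (if i = j then (Fintype.card H : ℂ) else 0) := by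
        intro i
        rw [← horth, Finset.mul_sum]
        refine Finset.sum_congr rfl fun g _ => by ring
      simp only [this]
      simp [mul_comm]
    simp [this]
  let z : MonoidAlgebra ℂ H := ∑ g, MonoidAlgebra.single g (f g)
  have hz : ∀ N : Submodule (MonoidAlgebra ℂ H) (MonoidAlgebra ℂ H),
      IsSimpleModule (MonoidAlgebra ℂ H) N → ∀ v ∈ N, z * v = 0 := by
    intro N hN v hv
    have hfin : Module.Finite ℂ N :=
      inferInstanceAs (Module.Finite ℂ (N.restrictScalars ℂ))
    have hs := fr_simple N
    obtain ⟨j, ⟨e⟩, -⟩ := hcomplete _ hs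
    have h1 : ∑ g, f g • (FDRep.of (Representation.ofModule' (k := ℂ) (G := H) N)).ρ g = 0 := by
      have h2 := htr j
      simp only [FDRep.Iso.conj_ρ e, ← map_smul, ← map_sum] at h2
      exact (LinearEquiv.map_eq_zero_iff _).1 h2
    rw [FDRep.of_ρ'] at h1
    have h3 := congrArg Subtype.val (LinearMap.congr_fun h1 ⟨v, hv⟩)
    have h4 : ∀ g, (((Representation.ofModule' (k := ℂ) (G := H) N) g ⟨v, hv⟩ : N) :
      MonoidAlgebra ℂ H) = MonoidAlgebra.single g 1 * v := fun g => rfl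
    simp only [LinearMap.sum_apply, LinearMap.smul_apply, LinearMap.zero_apply] at h3
    rw [Submodule.coe_sum] at h3
    simp only [z, Finset.sum_mul]
    refine Eq.trans (Finset.sum_congr rfl fun g _ => ?_) h3
    change _ = f g • (MonoidAlgebra.single g 1 * v)
    rw [← smul_mul_assoc]
    simp
  have hz1 : z * 1 = 0 := by
    have htop := IsSemisimpleModule.sSup_simples_eq_top (MonoidAlgebra ℂ H) (MonoidAlgebra ℂ H)
    have hle : sSup {m : Submodule (MonoidAlgebra ℂ H) (MonoidAlgebra ℂ H) |
        IsSimpleModule (MonoidAlgebra ℂ H) m}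
        ≤ ⊤ := le_top
    have hmem : (1 : MonoidAlgebra ℂ H) ∈ sSup {m : Submodule (MonoidAlgebra ℂ H) (MonoidAlgebra ℂ H) |
        IsSimpleModule (MonoidAlgebra ℂ H) m} := by rw [htop]; trivial
    rw [sSup_eq_iSup'] at hmem
    generalize (1 : MonoidAlgebra ℂ H) = u at hmem
    induction hmem using Submodule.iSup_induction' with
    | mem i x hx => exact hz i.1 i.2 x hx
    | zero => simp
    | add x y _ _ hx hy => rw [mul_add, hx, hy, add_zero]
  have hfx : f x⁻¹ = 0 := by
    have := congrArg (fun t : MonoidAlgebra ℂ H => t.coeff x⁻¹) hz1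
    simpa [z, MonoidAlgebra.coeff_single, Finsupp.single_apply] using this
  simp only [f, inv_inv, inv_eq_one] at hfx
  exact (sub_eq_zero.1 hfx).symm


lemma fr_trace {H : Type} [Group H] [Fintype H] (V : FDRep ℂ H) (p q r : H → ℂ) :
    LinearMap.trace ℂ V ((∑ a, p a • V.ρ a) * (∑ b, q b • V.ρ b) * (∑ c, r c • V.ρ c)) =
      ∑ a, ∑ b, ∑ c, p a * q b * r c * V.character (a * b * c) := by
  have h : ∀ a b c, V.character (a * b * c) = LinearMap.trace ℂ V (V.ρ a * V.ρ b * V.ρ c) := by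
    intro a b c
    rw [← map_mul, ← map_mul]
    rfl
  simp only [h]
  rw [Finset.sum_mul_sum, Finset.sum_mul, map_sum]
  refine Finset.sum_congr rfl fun a _ => ?_
  rw [Finset.sum_mul_sum, map_sum]
  refine Finset.sum_congr rfl fun b _ => ?_
  rw [map_sum]
  refine Finset.sum_congr rfl fun c _ => ?_
  rw [smul_mul_smul_comm, smul_mul_smul_comm, map_smul, smul_eq_mul]

/-- **Frobenius' formula.** For conjugacy classes `C₁, C₂, C₃` of a finite group `H` with
representatives `x₁, x₂, x₃`, the number of triples `(y₁, y₂, y₃) ∈ C₁ × C₂ × C₃` with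
`y₁y₂y₃ = 1` equals `(|C₁||C₂||C₃|/|H|) ⬝ Σ_χ χ(x₁)χ(x₂)χ(x₃)/χ(1)`, the sum ranging over
the irreducible complex characters of `H`. -/
theorem frobenius_triple_count (H : Type) [Group H] [Fintype H]
    (C₁ C₂ C₃ : Set H) (x₁ x₂ x₃ : H)
    (hC₁ : C₁ = {y | IsConj x₁ y}) (hC₂ : C₂ = {y | IsConj x₂ y})
    (hC₃ : C₃ = {y | IsConj x₃ y})
    (ι : Type) [Fintype ι] (V : ι → FDRep ℂ H)
    (hirr : ∀ i, Simple (V i))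
    (hcomplete : ∀ W : FDRep ℂ H, Simple W → ∃! i : ι, Nonempty (W ≅ V i)) :
    (Nat.card {t : H × H × H //
        t.1 ∈ C₁ ∧ t.2.1 ∈ C₂ ∧ t.2.2 ∈ C₃ ∧ t.1 * t.2.1 * t.2.2 = 1} : ℂ) =
      ((C₁.ncard : ℂ) * (C₂.ncard : ℂ) * (C₃.ncard : ℂ) / (Fintype.card H : ℂ)) *
        ∑ i : ι, (V i).character x₁ * (V i).character x₂ * (V i).character x₃ /
          (V i).character 1 := by
  classical
  have hne : (Fintype.card H : ℂ) ≠ 0 := Nat.cast_ne_zero.2 Fintype.card_ne_zero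
  rw [div_mul_eq_mul_div, eq_div_iff hne]
  let e : H → H → ℂ := fun x y => if IsConj x y then 1 else 0
  have hN : (Nat.card {t : H × H × H //
        t.1 ∈ C₁ ∧ t.2.1 ∈ C₂ ∧ t.2.2 ∈ C₃ ∧ t.1 * t.2.1 * t.2.2 = 1} : ℂ) * Fintype.card H =
      ∑ a, ∑ b, ∑ c, e x₁ a * e x₂ b * e x₃ c *
        ∑ i, (V i).character 1 * (V i).character (a * b * c) := by
    simp only [fr_regular ι V hirr hcomplete]
    rw [Nat.card_eq_fintype_card, Fintype.card_subtype, ← Finset.sum_boole, Finset.sum_mul,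
      Fintype.sum_prod_type]
    refine Finset.sum_congr rfl fun a _ => ?_
    rw [Fintype.sum_prod_type]
    refine Finset.sum_congr rfl fun b _ => Finset.sum_congr rfl fun c _ => ?_
    simp only [hC₁, hC₂, hC₃, Set.mem_ofPred_eq, e]
    by_cases h1 : IsConj x₁ a <;> by_cases h2 : IsConj x₂ b <;> by_cases h3 : IsConj x₃ c <;>
      simp [-isConj_iff, h1, h2, h3]
  have hi : ∀ i, ∑ a, ∑ b, ∑ c, e x₁ a * e x₂ b * e x₃ c * (V i).character (a * b * c) =
      (C₁.ncard : ℂ) * (C₂.ncard : ℂ) * (C₃.ncard : ℂ) *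
        ((V i).character x₁ * (V i).character x₂ * (V i).character x₃) /
          (V i).character 1 ^ 2 := by
    intro i
    have hd := fr_dim_ne (V i)
    rw [← fr_trace, fr_conj, fr_conj, fr_conj, ← hC₁, ← hC₂, ← hC₃, smul_mul_smul_comm,
      smul_mul_smul_comm, map_smul, one_mul, one_mul, LinearMap.trace_one, ← FDRep.char_one,
      smul_eq_mul]
    field_simp
  rw [hN, Finset.mul_sum]
  have hsw : ∑ a, ∑ b, ∑ c, e x₁ a * e x₂ b * e x₃ c *
        ∑ i, (V i).character 1 * (V i).character (a * b * c) =
      ∑ i, (V i).character 1 *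
        ∑ a, ∑ b, ∑ c, e x₁ a * e x₂ b * e x₃ c * (V i).character (a * b * c) := by
    simp only [Finset.mul_sum]
    rw [Finset.sum_comm (s := (Finset.univ : Finset ι))]
    refine Finset.sum_congr rfl fun a _ => ?_
    rw [Finset.sum_comm (s := (Finset.univ : Finset ι))]
    refine Finset.sum_congr rfl fun b _ => ?_
    rw [Finset.sum_comm (s := (Finset.univ : Finset ι))]
    refine Finset.sum_congr rfl fun c _ => Finset.sum_congr rfl fun i _ => by ring
  rw [hsw]
  refine Finset.sum_congr rfl fun i _ => ?_
  have hd := fr_dim_ne (V i)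
  rw [hi]
  field_simp
end

section
/- Let H be a finite group and let g ≥ 1 be an integer. Then the number of 2g-tuples (a₁, b₁, …, a_g, b_g) ∈ H^{2g} satisfying [a₁,b₁][a₂,b₂]⋯[a_g,b_g] = 1 equals |H|^{2g−1} · Σ_χ χ(1)^{2−2g}, where the sum ranges over all irreducible complex characters χ of H (the equality being between the natural number cast into ℂ and the complex-valued expression). -/
open CategoryTheory

namespace FrobMed
variable {H : Type} [Group H] [Fintype H]

theorem dim_ne (V : FDRep ℂ H) [Simple V] : (Module.finrank ℂ V : ℂ) ≠ 0 := by
  intro h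
  have h0 : Module.finrank ℂ V = 0 := by exact_mod_cast h
  have : Subsingleton V := Module.finrank_zero_iff.mp h0
  have h1 := (FDRep.simple_iff_char_is_norm_one V).1 inferInstance
  have h2 : ∀ x : H, V.character x = 0 := by
    intro x
    have : V.ρ x = 0 := Subsingleton.elim _ _
    simp [FDRep.character, this]
  simp [h2] at h1
  exact Fintype.card_ne_zero (α := H) (by exact_mod_cast h1.symm)

theorem schur (V : FDRep ℂ H) [Simple V] (f : V →ₗ[ℂ] V)
    (hf : ∀ x, f ∘ₗ V.ρ x = V.ρ x ∘ₗ f) :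
    f = (LinearMap.trace ℂ V f / Module.finrank ℂ V) • LinearMap.id := by
  have h1 := finrank_endomorphism_simple_eq_one ℂ V
  rw [← LinearEquiv.finrank_eq (Representation.linHom.invariantsEquivFDRepHom V V)] at h1
  have hmem : ∀ f : V →ₗ[ℂ] V, (∀ x, f ∘ₗ V.ρ x = V.ρ x ∘ₗ f) →
      f ∈ (Representation.linHom V.ρ V.ρ).invariants := by
    intro f hf
    rw [Representation.mem_invariants]
    intro x
    rw [Representation.linHom_apply, hf, ← LinearMap.comp_assoc,
      ← Module.End.mul_eq_comp (V.ρ x), ← map_mul]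
    simp [Module.End.one_eq_id]
  have hne : (⟨LinearMap.id, hmem _ (fun x => rfl)⟩ :
      (Representation.linHom V.ρ V.ρ).invariants) ≠ 0 := by
    intro h
    have h' : (LinearMap.id : V →ₗ[ℂ] V) = 0 := congrArg Subtype.val h
    have := congrArg (LinearMap.trace ℂ V) h'
    rw [LinearMap.trace_id, map_zero] at this
    exact dim_ne V this
  obtain ⟨c, hc⟩ := (finrank_eq_one_iff_of_nonzero' _ hne).mp h1 ⟨f, hmem f hf⟩
  have hc' : c • (LinearMap.id : V →ₗ[ℂ] V) = f := congrArg Subtype.val hc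
  rw [← hc', map_smul, LinearMap.trace_id, smul_eq_mul, mul_div_cancel_right₀ _ (dim_ne V)]

theorem classfun_schur (V : FDRep ℂ H) [Simple V] (f : H → ℂ)
    (hf : ∀ x h, f (x * h * x⁻¹) = f h) :
    ∑ h, f h • V.ρ h =
      ((∑ h, f h * V.character h) / Module.finrank ℂ V) • LinearMap.id := by
  have := schur V (∑ h, f h • V.ρ h) (by
    intro x
    rw [← Module.End.mul_eq_comp, ← Module.End.mul_eq_comp, Finset.sum_mul, Finset.mul_sum]
    rw [← Equiv.sum_comp (MulAut.conj x).toEquiv]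
    refine Finset.sum_congr rfl fun h _ => ?_
    simp [hf, ← map_mul])
  rw [this]
  simp [map_sum, FDRep.character]

theorem simple_of (M : Type) [AddCommGroup M] [Module ℂ M] [Module.Finite ℂ M]
    (ρ : Representation ℂ H M) [ρ.IsIrreducible] : Simple (FDRep.of ρ) := by
  rw [FDRep.simple_iff_char_is_norm_one]
  have := invertibleOfNonzero (NeZero.ne (Nat.card H : ℂ))
  have h := Representation.char_orthonormal ρ ρ
  rw [if_pos ⟨Representation.Equiv.refl _⟩, inv_mul_eq_one₀ (NeZero.ne _)] at h
  exact_mod_cast h.symm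

theorem kills_simple (M : Type) [AddCommGroup M] [Module ℂ M] [Module (MonoidAlgebra ℂ H) M]
    [IsScalarTower ℂ (MonoidAlgebra ℂ H) M] [IsSimpleModule (MonoidAlgebra ℂ H) M]
    (α : MonoidAlgebra ℂ H)
    (h : ∀ (W : FDRep ℂ H), Simple W → Representation.asAlgebraHom W.ρ α = 0) (x : M) :
    α • x = 0 := by
  have : Module.Finite (MonoidAlgebra ℂ H) M := inferInstance
  have : Module.Finite ℂ M := Module.Finite.trans (MonoidAlgebra ℂ H) _
  let ρ : Representation ℂ H M := Representation.ofModule' M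
  have hρ : ∀ (r : MonoidAlgebra ℂ H) (x : M), ρ.asAlgebraHom r x = r • x := by
    intro r x
    have : ρ.asAlgebraHom = Algebra.lsmul ℂ ℂ M :=
      (MonoidAlgebra.lift ℂ (M →ₗ[ℂ] M) H).apply_symm_apply (Algebra.lsmul ℂ ℂ M)
    rw [this]; rfl
  let e : ρ.asModule ≃ₗ[MonoidAlgebra ℂ H] M :=
    { ρ.asModuleEquiv.toAddEquiv with
      map_smul' := fun r x => by
        have := ρ.asModuleEquiv_map_smul r x
        rw [hρ] at this
        exact this }
  have : ρ.IsIrreducible := by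
    rw [Representation.irreducible_iff_isSimpleModule_asModule]
    exact IsSimpleModule.congr e
  have hs := h _ (simple_of M ρ)
  rw [FDRep.of_ρ'] at hs
  rw [← hρ, hs]; rfl

theorem eq_zero_of_kills (α : MonoidAlgebra ℂ H)
    (h : ∀ (W : FDRep ℂ H), Simple W → Representation.asAlgebraHom W.ρ α = 0) : α = 0 := by
  have key : ∀ (S : Submodule (MonoidAlgebra ℂ H) (MonoidAlgebra ℂ H)),
      IsSimpleModule (MonoidAlgebra ℂ H) S → ∀ x ∈ S, α * x = 0 := by
    intro S hS x hx
    have h3 := kills_simple S α h ⟨x, hx⟩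
    exact congrArg Subtype.val h3
  have htop := IsSemisimpleModule.sSup_simples_eq_top (MonoidAlgebra ℂ H) (MonoidAlgebra ℂ H)
  have hall : ∀ x : MonoidAlgebra ℂ H, α * x = 0 := by
    intro x
    have hx : x ∈ (⊤ : Submodule (MonoidAlgebra ℂ H) (MonoidAlgebra ℂ H)) := trivial
    rw [← htop, sSup_eq_iSup'] at hx
    induction hx using Submodule.iSup_induction' with
    | mem i x hx => exact key i.1 i.2 x hx
    | zero => simp
    | add x y _ _ hx hy => rw [mul_add, hx, hy, add_zero]
  simpa using hall 1

theorem regular {ι : Type} [Fintype ι] (V : ι → FDRep ℂ H)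
    (hirr : ∀ i, Simple (V i))
    (hcomplete : ∀ W : FDRep ℂ H, Simple W → ∃! i : ι, Nonempty (W ≅ V i)) (h : H)
    [Decidable (h = 1)] :
    ∑ i, (Module.finrank ℂ (V i) : ℂ) * (V i).character h =
      if h = 1 then (Fintype.card H : ℂ) else 0 := by
  classical
  let f : H → ℂ := fun h => (if h = 1 then (Fintype.card H : ℂ) else 0) -
    ∑ i, (Module.finrank ℂ (V i) : ℂ) * (V i).character h⁻¹
  have hz : ∑ h, MonoidAlgebra.single h (f h) = 0 := by
    apply eq_zero_of_kills
    intro W hW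
    simp only [map_sum, Representation.asAlgebraHom_single]
    rw [classfun_schur]
    · have hcalc : ∑ h, f h * W.character h = 0 := by
        obtain ⟨i₀, ⟨e⟩, hu⟩ := hcomplete W hW
        have := invertibleOfNonzero (NeZero.ne (Nat.card H : ℂ))
        have horth : ∀ i, ∑ h, W.character h * (V i).character h⁻¹ =
            if i = i₀ then (Fintype.card H : ℂ) else 0 := by
          intro i
          have := hirr i
          have h1 := FDRep.char_orthonormal W (V i)
          have hiff : Nonempty (W ≅ V i) ↔ i = i₀ :=
            ⟨fun h => hu i h, fun h => h ▸ ⟨e⟩⟩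
          rw [inv_mul_eq_iff_eq_mul₀ (NeZero.ne _)] at h1
          rw [h1]
          simp [hiff]
        simp only [f, sub_mul, Finset.sum_sub_distrib, Finset.sum_mul]
        have : ∀ i, ∑ h, (Module.finrank ℂ (V i) : ℂ) * (V i).character h⁻¹ * W.character h =
            (Module.finrank ℂ (V i) : ℂ) * if i = i₀ then (Fintype.card H : ℂ) else 0 := by
          intro i
          rw [← horth, Finset.mul_sum]
          exact Finset.sum_congr rfl fun h _ => by ring
        have hd := congrFun (FDRep.char_iso e) 1
        simp only [FDRep.char_one] at hd
        rw [Finset.sum_comm (f := fun h i =>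
          (Module.finrank ℂ (V i) : ℂ) * (V i).character h⁻¹ * W.character h)]
        simp only [this]
        simp [hd, mul_comm]
      rw [hcalc]; simp
    · intro x h
      have : (x * h * x⁻¹)⁻¹ = x * h⁻¹ * x⁻¹ := by group
      simp only [f, this, FDRep.char_conj]
      simp
  have h2 := congrArg (fun a : MonoidAlgebra ℂ H => a.coeff h⁻¹) hz
  have h3 : f h⁻¹ = 0 := by
    simpa [MonoidAlgebra.coeff_sum, Finsupp.single_apply, Finsupp.finsetSum_apply] using h2
  simp only [f, inv_inv, inv_eq_one] at h3
  rw [← sub_eq_zero.1 h3]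

theorem comm_sum (V : FDRep ℂ H) [Simple V] :
    ∑ p : H × H, V.ρ (p.1⁻¹ * p.2⁻¹ * p.1 * p.2) =
      (((Fintype.card H : ℂ) / Module.finrank ℂ V) ^ 2) • (1 : Module.End ℂ V) := by
  have hd := dim_ne V
  have h1 : ∀ x : H, ∑ a, V.ρ (a⁻¹ * x * a) =
      ((Fintype.card H : ℂ) / Module.finrank ℂ V * V.character x) • (1 : Module.End ℂ V) := by
    intro x
    have := schur V (∑ a, V.ρ (a⁻¹ * x * a)) (by
      intro y
      rw [← Module.End.mul_eq_comp, ← Module.End.mul_eq_comp, Finset.sum_mul, Finset.mul_sum]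
      symm
      rw [← Equiv.sum_comp (Equiv.mulRight y)]
      refine Finset.sum_congr rfl fun h _ => ?_
      simp [← map_mul, mul_assoc])
    rw [this, map_sum]
    have h2 : ∀ a : H, LinearMap.trace ℂ V (V.ρ (a⁻¹ * x * a)) = V.character x := by
      intro a
      have := FDRep.char_conj V x a⁻¹
      rwa [inv_inv] at this
    simp only [h2, Finset.sum_const, Finset.card_univ, nsmul_eq_mul, Module.End.one_eq_id]
    congr 1; ring
  rw [Fintype.sum_prod_type_right]
  have h3 : ∀ b : H, ∑ a : H, V.ρ (a⁻¹ * b⁻¹ * a * b) =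
      ((Fintype.card H : ℂ) / Module.finrank ℂ V) • (V.character b⁻¹ • V.ρ b) := by
    intro b
    simp only [map_mul V.ρ _ b]
    rw [← Finset.sum_mul, h1, smul_mul_assoc, one_mul, mul_smul]
  simp only [h3]
  rw [← Finset.smul_sum, classfun_schur V (fun h => V.character h⁻¹)]
  · have h4 := (FDRep.simple_iff_char_is_norm_one V).1 inferInstance
    simp only [mul_comm (V.character _⁻¹), h4, Nat.card_eq_fintype_card, smul_smul,
      Module.End.one_eq_id]
    congr 1; ring
  · intro x h
    have : (x * h * x⁻¹)⁻¹ = x * h⁻¹ * x⁻¹ := by group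
    simp only [this, FDRep.char_conj]

theorem tuple_sum (V : FDRep ℂ H) [Simple V] (g : ℕ) :
    ∑ a : Fin g → H × H, V.ρ
      (List.ofFn (fun i => ((a i).1)⁻¹ * ((a i).2)⁻¹ * (a i).1 * (a i).2)).prod =
      (((Fintype.card H : ℂ) / Module.finrank ℂ V) ^ (2 * g)) • (1 : Module.End ℂ V) := by
  induction g with
  | zero => simp
  | succ n ih =>
    rw [← Equiv.sum_comp (Fin.consEquiv (fun _ => H × H)), Fintype.sum_prod_type]
    simp only [Fin.consEquiv_apply, List.ofFn_succ, Fin.cons_zero, Fin.cons_succ, List.prod_cons]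
    simp only [map_mul V.ρ _ (List.prod _)]
    simp only [← Finset.mul_sum, ih]
    rw [← Finset.sum_mul, comm_sum, smul_mul_smul_comm, mul_one]
    congr 1; ring

end FrobMed

/-- **Frobenius–Mednykh formula.** For a finite group `H` and `g ≥ 1`, the number of
`2g`-tuples `(a₁, b₁, …, a_g, b_g)` in `H` with `[a₁,b₁]⋯[a_g,b_g] = 1` (where
`[a,b] = a⁻¹b⁻¹ab`) equals `|H|^{2g-1} ⬝ Σ_χ χ(1)^{2-2g}`, the sum ranging over the
irreducible complex characters of `H`. -/
theorem frobenius_mednykh (H : Type) [Group H] [Fintype H]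
    (g : ℕ) (hg : 1 ≤ g)
    (ι : Type) [Fintype ι] (V : ι → FDRep ℂ H)
    (hirr : ∀ i, Simple (V i))
    (hcomplete : ∀ W : FDRep ℂ H, Simple W → ∃! i : ι, Nonempty (W ≅ V i)) :
    (Nat.card {a : Fin g → H × H //
        (List.ofFn (fun i => ((a i).1)⁻¹ * ((a i).2)⁻¹ * (a i).1 * (a i).2)).prod = 1} : ℂ) =
      (Fintype.card H : ℂ) ^ (2 * (g : ℤ) - 1) *
        ∑ i : ι, (V i).character 1 ^ (2 - 2 * (g : ℤ)) := by
  classical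
  have hH : (Fintype.card H : ℂ) ≠ 0 := by simp
  apply mul_left_cancel₀ hH
  rw [Nat.card_eq_fintype_card, Fintype.card_subtype, Finset.card_filter]
  push_cast
  rw [Finset.mul_sum]
  simp only [mul_ite, mul_one, mul_zero]
  simp only [← FrobMed.regular V hirr hcomplete]
  rw [Finset.sum_comm, Finset.mul_sum, Finset.mul_sum]
  refine Finset.sum_congr rfl fun i _ => ?_
  have := hirr i
  have hd := FrobMed.dim_ne (V i)
  have ht := congrArg (LinearMap.trace ℂ (V i)) (FrobMed.tuple_sum (V i) g)
  rw [map_sum, map_smul, LinearMap.trace_one] at ht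
  rw [← Finset.mul_sum]
  simp only [FDRep.character] at ht ⊢
  rw [ht, map_one, LinearMap.trace_one, zpow_sub₀ hH, zpow_sub₀ hd, zpow_one]
  have e : (2 * (g : ℤ)) = ((2 * g : ℕ) : ℤ) := by push_cast; rfl
  rw [e, zpow_natCast, zpow_natCast, div_pow, smul_eq_mul]
  field_simp
  try norm_cast
end

section
/- Let H be a finite group and let g ≥ 1 be an integer. Then the number of g-tuples (a₁, …, a_g) ∈ H^g satisfying a₁²a₂²⋯a_g² = 1 equals |H|^{g−1} · Σ_χ c_χ^g · χ(1)^{2−g}, where the sum ranges over all irreducible complex characters χ of H and c_χ := |H|⁻¹ Σ_{h∈H} χ(h²) is the Frobenius–Schur indicator of χ (the equality being between the natural number cast into ℂ and the complex-valued expression). -/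
open CategoryTheory

namespace FSaux
variable {H : Type} [Group H] [Fintype H]

lemma schur (V : FDRep ℂ H) [Simple V] (T : V →ₗ[ℂ] V)
    (hT : ∀ h, T ∘ₗ V.ρ h = V.ρ h ∘ₗ T) : ∃ c : ℂ, T = c • LinearMap.id := by
  let f : V ⟶ V := ⟨InducedCategory.homMk (ModuleCat.ofHom T), fun h => by
    ext x
    exact LinearMap.congr_fun (hT h) x⟩
  obtain ⟨c, hc⟩ := endomorphism_simple_eq_smul_id ℂ f
  refine ⟨c, ?_⟩
  have := congrArg (fun q : V ⟶ V => q.hom.hom.hom) hc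
  exact this.symm

lemma dim_ne (V : FDRep ℂ H) [hV : Simple V] : V.character 1 ≠ 0 := by
  intro h0
  rw [FDRep.char_one, Nat.cast_eq_zero] at h0
  have := (FDRep.simple_iff_char_is_norm_one V).1 hV
  have hs : Subsingleton V := Module.finrank_zero_iff.1 h0
  have hz : ∀ h, V.character h = 0 := fun h => by
    have : V.ρ h = 0 := by ext x; exact Subsingleton.elim _ _
    simp [FDRep.character, this]
  simp [hz] at this
  exact NeZero.ne (Fintype.card H : ℂ) this.symm

lemma schur' (V : FDRep ℂ H) [Simple V] (T : V →ₗ[ℂ] V)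
    (hT : ∀ h, T ∘ₗ V.ρ h = V.ρ h ∘ₗ T) :
    T = (LinearMap.trace ℂ V T / V.character 1) • LinearMap.id := by
  obtain ⟨c, hc⟩ := schur V T hT
  have hd := dim_ne V
  rw [FDRep.char_one] at *
  have : LinearMap.trace ℂ V T = c * Module.finrank ℂ V := by
    rw [hc]; simp
  rw [this, mul_div_cancel_right₀ _ hd]
  exact hc

lemma class_comm (V : FDRep ℂ H) (f : H → ℂ) (s : H → H) (hf : ∀ k h, f (k * h * k⁻¹) = f h)
    (hs : ∀ k h, s (k * h * k⁻¹) = k * s h * k⁻¹) (k : H) :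
    (∑ h, f h • V.ρ (s h)) * V.ρ k = V.ρ k * (∑ h, f h • V.ρ (s h)) := by
  rw [Finset.sum_mul, Finset.mul_sum]
  symm
  refine Fintype.sum_equiv (MulAut.conj k).toEquiv _ _ fun h => ?_
  have e : (MulAut.conj k).toEquiv h = k * h * k⁻¹ := rfl
  rw [e, hf, hs, smul_mul_assoc, mul_smul_comm, ← map_mul, ← map_mul]
  simp

lemma simple_of {W : Type} [AddCommGroup W] [Module ℂ W] [Module.Finite ℂ W]
    (σ : Representation ℂ H W) [σ.IsIrreducible] : Simple (FDRep.of σ) := by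
  rw [FDRep.simple_iff_char_is_norm_one]
  have := invertibleOfNonzero (NeZero.ne (Nat.card H : ℂ))
  have h := Representation.card_inv_mul_sum_char_mul_char_eq_finrank σ σ
  rw [Representation.IsIrreducible.finrank_intertwiningMap_self, Nat.cast_one,
    inv_mul_eq_one₀ (NeZero.ne _)] at h
  exact h.symm

lemma sum_tuples (V : FDRep ℂ H) (g : ℕ) :
    ∑ a : Fin g → H, V.ρ (List.ofFn (fun i => (a i) ^ 2)).prod = (∑ h, V.ρ (h ^ 2)) ^ g := by
  induction g with
  | zero => simp
  | succ n ih =>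
    rw [← (Fin.consEquiv (fun _ => H)).sum_comp, Fintype.sum_prod_type, pow_succ', ← ih,
      Finset.sum_mul_sum]
    simp [Fin.consEquiv, List.ofFn_succ]

lemma simple_smul {ι : Type} [Fintype ι] (V : ι → FDRep ℂ H)
    (hcomplete : ∀ W : FDRep ℂ H, Simple W → ∃! i : ι, Nonempty (W ≅ V i)) (f : H → ℂ)
    (hV : ∀ j, ∑ h, f h • (V j).ρ h = (Fintype.card H : ℂ) • LinearMap.id)
    (M : Type) [AddCommGroup M] [Module ℂ M] [Module (MonoidAlgebra ℂ H) M]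
    [IsScalarTower ℂ (MonoidAlgebra ℂ H) M]
    [hsim : IsSimpleModule (MonoidAlgebra ℂ H) M] (m : M) :
    (∑ h, MonoidAlgebra.single h (f h)
      - MonoidAlgebra.single 1 (Fintype.card H : ℂ) : MonoidAlgebra ℂ H) • m = 0 := by
  let σ : Representation ℂ H M := Representation.ofModule' M
  have hact : ∀ (r : MonoidAlgebra ℂ H) (m : M), σ.asAlgebraHom r m = r • m := fun r m => by
    have : σ.asAlgebraHom = Algebra.lsmul ℂ ℂ M :=
      (MonoidAlgebra.lift ℂ (M →ₗ[ℂ] M) H).apply_symm_apply _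
    rw [this]; rfl
  let E : σ.asModule ≃ₗ[MonoidAlgebra ℂ H] M :=
    { σ.asModuleEquiv.toAddEquiv with
      map_smul' := fun r x => (σ.asModuleEquiv_map_smul r x).trans (hact r _) }
  have : σ.IsIrreducible :=
    (Representation.irreducible_iff_isSimpleModule_asModule σ).2 (IsSimpleModule.congr E)
  have : Module.Finite ℂ M := Module.Finite.trans (MonoidAlgebra ℂ H) _
  obtain ⟨i, ⟨e⟩, -⟩ := hcomplete (FDRep.of σ) (simple_of σ)
  have hσ : ∑ h, f h • σ h = (Fintype.card H : ℂ) • LinearMap.id := by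
    have h1 : ∀ h, σ h = (FDRep.isoToLinearEquiv e.symm).conj ((V i).ρ h) :=
      fun h => FDRep.Iso.conj_ρ e.symm h
    have h2 := congrArg (FDRep.isoToLinearEquiv e.symm).conj (hV i)
    rw [map_sum, map_smul, LinearEquiv.conj_id] at h2
    simp only [map_smul] at h2
    simp only [h1]
    exact h2
  have hz : σ.asAlgebraHom (∑ h, MonoidAlgebra.single h (f h)
      - MonoidAlgebra.single 1 (Fintype.card H : ℂ) : MonoidAlgebra ℂ H) = 0 := by
    simp only [map_sub, map_sum, Representation.asAlgebraHom_single, hσ, map_one]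
    simp [Module.End.one_eq_id]
  rw [← hact, hz, LinearMap.zero_apply]

lemma reg_char {ι : Type} [Fintype ι] (V : ι → FDRep ℂ H)
    (hirr : ∀ i, Simple (V i))
    (hcomplete : ∀ W : FDRep ℂ H, Simple W → ∃! i : ι, Nonempty (W ≅ V i)) [DecidableEq H] (x : H) :
    ∑ i, (V i).character 1 * (V i).character x = if x = 1 then (Fintype.card H : ℂ) else 0 := by
  classical
  have := invertibleOfNonzero (NeZero.ne (Nat.card H : ℂ))
  set f : H → ℂ := fun h => ∑ i, (V i).character 1 * (V i).character h⁻¹ with hf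
  have hfc : ∀ k h, f (k * h * k⁻¹) = f h := fun k h => by
    simp only [hf]
    refine Finset.sum_congr rfl fun i _ => ?_
    rw [← (V i).char_conj h⁻¹ k]
    simp [mul_assoc]
  let y : MonoidAlgebra ℂ H := ∑ h, MonoidAlgebra.single h (f h)
    - MonoidAlgebra.single 1 (Fintype.card H : ℂ)
  have hnon : ∀ i j, Nonempty (V j ≅ V i) ↔ i = j := fun i j => by
    obtain ⟨l, -, hl⟩ := hcomplete (V j) (hirr j)
    constructor
    · intro h
      rw [hl i h, hl j ⟨Iso.refl _⟩]
    · rintro rfl; exact ⟨Iso.refl _⟩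
  have hV : ∀ j, ∑ h, f h • (V j).ρ h = (Fintype.card H : ℂ) • LinearMap.id := fun j => by
    have := hirr j
    rw [schur' (V j) (∑ h, f h • (V j).ρ h)
      (fun k => class_comm (V j) f id hfc (by simp) k)]
    congr 1
    rw [div_eq_iff (dim_ne (V j))]
    simp only [map_sum, map_smul, smul_eq_mul, hf, Finset.sum_mul]
    rw [Finset.sum_comm]
    have key : ∀ i, ∑ h, (V j).character h * (V i).character h⁻¹ =
        if i = j then (Fintype.card H : ℂ) else 0 := fun i => by
      have := hirr i
      have h := FDRep.char_orthonormal (V j) (V i)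
      simp only [hnon] at h
      rw [inv_mul_eq_iff_eq_mul₀ (NeZero.ne _)] at h
      rw [h]; simp
    calc _ = ∑ i, (V i).character 1 * ∑ h, (V j).character h * (V i).character h⁻¹ := by
          refine Finset.sum_congr rfl fun i _ => ?_
          rw [Finset.mul_sum]
          refine Finset.sum_congr rfl fun h _ => ?_
          change _ * (V j).character h = _
          ring
      _ = _ := by simp [key, mul_comm]
  have hy : y ∈ Ring.jacobson (MonoidAlgebra ℂ H) := by
    rw [Ring.jacobson, Module.jacobson, Submodule.mem_sInf]
    intro m hm
    have hsim : IsSimpleModule (MonoidAlgebra ℂ H) (MonoidAlgebra ℂ H ⧸ m) :=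
      isSimpleModule_iff_isCoatom.2 hm
    have h0 := simple_smul V hcomplete f hV (MonoidAlgebra ℂ H ⧸ m) (Submodule.Quotient.mk 1)
    rw [← Submodule.Quotient.mk_smul, smul_eq_mul, mul_one, Submodule.Quotient.mk_eq_zero] at h0
    exact h0
  rw [IsSemisimpleRing.jacobson_eq_bot, Submodule.mem_bot] at hy
  have h1 := congrArg (fun q : MonoidAlgebra ℂ H => q.coeff x⁻¹) hy
  simp [y, MonoidAlgebra.coeff_single, Finsupp.single_apply, hf, sub_eq_zero] at h1
  simp [h1, eq_comm]
end FSaux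

open FSaux in
theorem frobenius_schur (H : Type) [Group H] [Fintype H]
    (g : ℕ) (hg : 1 ≤ g)
    (ι : Type) [Fintype ι] (V : ι → FDRep ℂ H)
    (hirr : ∀ i, Simple (V i))
    (hcomplete : ∀ W : FDRep ℂ H, Simple W → ∃! i : ι, Nonempty (W ≅ V i)) :
    (Nat.card {a : Fin g → H //
        (List.ofFn (fun i => (a i) ^ 2)).prod = 1} : ℂ) =
      (Fintype.card H : ℂ) ^ ((g : ℤ) - 1) *
        ∑ i : ι, ((Fintype.card H : ℂ)⁻¹ * ∑ h : H, (V i).character (h ^ 2)) ^ g *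
          (V i).character 1 ^ (2 - (g : ℤ)) := by
  classical
  have hc : (Fintype.card H : ℂ) ≠ 0 := by simp
  have hi : ∀ i, ∑ a : Fin g → H, (V i).character (List.ofFn (fun i => (a i) ^ 2)).prod
      = ((∑ h, (V i).character (h ^ 2)) / (V i).character 1) ^ g * (V i).character 1 := fun i => by
    have := hirr i
    have h1 := schur' (V i) (∑ h, (V i).ρ (h ^ 2)) (fun k => by
      simpa only [Pi.one_apply, one_smul] using! class_comm (V i) 1 (· ^ 2) (by simp) (by simp [pow_two]) k)
    have h2 := congrArg (LinearMap.trace ℂ (V i)) (sum_tuples (V i) g)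
    rw [h1, map_sum] at h2
    refine Eq.trans h2 ?_
    rw [← Module.End.one_eq_id, smul_pow, one_pow, map_smul, LinearMap.trace_one, map_sum,
      FDRep.char_one]
    rfl
  have h3 : (Nat.card {a : Fin g → H //
      (List.ofFn (fun i => (a i) ^ 2)).prod = 1} : ℂ) = (Fintype.card H : ℂ)⁻¹ *
      ∑ a : Fin g → H, ∑ i, (V i).character 1 *
        (V i).character (List.ofFn (fun i => (a i) ^ 2)).prod := by
    simp_rw [reg_char V hirr hcomplete]
    rw [Nat.card_eq_fintype_card, Fintype.card_subtype, ← Finset.sum_filter, Finset.sum_const]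
    simp [mul_comm, hc]
  rw [h3, Finset.sum_comm]
  simp_rw [← Finset.mul_sum, hi]
  rw [Finset.mul_sum, Finset.mul_sum]
  refine Finset.sum_congr rfl fun i _ => ?_
  have := hirr i
  have hd := dim_ne (V i)
  rw [zpow_sub₀ hc, zpow_sub₀ hd, zpow_natCast, zpow_natCast, zpow_one, mul_pow, div_pow, inv_pow]
  have : (V i).character 1 ^ (2 : ℤ) = (V i).character 1 ^ 2 := by norm_cast
  rw [this]
  field_simp
end

section
/- Let G be a finite group and H a subgroup of G. If μ_G(H) ≠ 0, then H is an intersection of maximal subgroups of G, i.e., H equals the intersection of some (possibly empty) family of maximal proper subgroups of G (where the empty intersection is G itself). -/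
open Classical in
/-- **Hall.** If `G` is a finite group with Möbius function `μ` on its subgroup lattice
(defined by `Σ_{K ≥ H} μ(K) = δ_{H,⊤}`) and `H` is a subgroup with `μ(H) ≠ 0`, then `H` is
an intersection of maximal (proper) subgroups of `G` (the empty intersection being `G`). -/
theorem moebius_ne_zero_inter_maximal (G : Type*) [Group G] [Fintype G]
    (μ : Subgroup G → ℤ)
    (hμ : ∀ H : Subgroup G,
      (∑ K ∈ Finset.univ.filter (fun K : Subgroup G => H ≤ K), μ K) =
        if H = ⊤ then 1 else 0)
    (H : Subgroup G) (hH : μ H ≠ 0) :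
    ∃ S : Set (Subgroup G), (∀ M ∈ S, IsCoatom M) ∧ H = sInf S := by
  have key : ∀ H : Subgroup G, H ≠ sInf {M | IsCoatom M ∧ H ≤ M} → μ H = 0 := by
    intro H
    induction H using WellFoundedGT.induction with
    | ind H ih =>
      intro hne
      set C := sInf {M : Subgroup G | IsCoatom M ∧ H ≤ M} with hC
      have hHC : H ≤ C := le_sInf fun M hM => hM.2
      have hHtop : H ≠ ⊤ := by
        intro h
        exact hne (le_antisymm hHC (h ▸ le_top))
      have hCtop : C ≠ ⊤ := by
        obtain h | ⟨M, hM, hHM⟩ := eq_top_or_exists_le_coatom H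
        · exact absurd h hHtop
        · intro h
          have : C ≤ M := sInf_le ⟨hM, hHM⟩
          exact hM.1 (top_le_iff.mp (h ▸ this))
      have h1 := hμ H
      have h2 := hμ C
      rw [if_neg hHtop] at h1
      rw [if_neg hCtop] at h2
      have hsub : insert H (Finset.univ.filter (fun K : Subgroup G => C ≤ K)) ⊆
          Finset.univ.filter (fun K : Subgroup G => H ≤ K) := by
        intro K hK
        simp only [Finset.mem_insert, Finset.mem_filter, Finset.mem_univ, true_and] at hK ⊢
        rcases hK with rfl | hK
        · exact le_rfl
        · exact hHC.trans hK
      have hs := Finset.sum_subset (f := μ) hsub (by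
        intro K hK hK2
        simp only [Finset.mem_insert, Finset.mem_filter, Finset.mem_univ, true_and,
          not_or] at hK hK2
        refine ih K (lt_of_le_of_ne hK (Ne.symm hK2.1)) ?_
        intro h
        apply hK2.2
        rw [h]
        exact sInf_le_sInf fun M hM => ⟨hM.1, hK.trans hM.2⟩)
      rw [Finset.sum_insert, h1, h2, add_zero] at hs
      · exact hs
      · simp only [Finset.mem_filter, Finset.mem_univ, true_and]
        intro h
        exact hne (le_antisymm hHC h)
  refine ⟨{M | IsCoatom M ∧ H ≤ M}, fun M hM => hM.1, ?_⟩
  by_contra h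
  exact hH (key H h)
end

section
/- Define, for each odd positive integer e, χ(e) = 1 if e ≡ 1 or 7 (mod 8) and χ(e) = −1 if e ≡ 3 or 5 (mod 8), and set a₁(e) = 2^e + χ(e)·2^{(e+1)/2} + 1 and a₂(e) = 2^e − χ(e)·2^{(e+1)/2} + 1. Then for all odd positive integers f and e with f dividing e, a₁(f) divides a₁(e) and a₂(f) divides a₂(e). -/
/-- The sign `χ(e)`: `1` if `e ≡ ±1 (mod 8)`, `−1` if `e ≡ ±3 (mod 8)`. -/
def suzukiChi (e : ℕ) : ℤ := if e % 8 = 1 ∨ e % 8 = 7 then 1 else -1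

/-- `a₁(e) = 2^e + χ(e)·2^{(e+1)/2} + 1`. -/
def suzukiA1 (e : ℕ) : ℤ := 2 ^ e + suzukiChi e * 2 ^ ((e + 1) / 2) + 1

/-- `a₂(e) = 2^e − χ(e)·2^{(e+1)/2} + 1`. -/
def suzukiA2 (e : ℕ) : ℤ := 2 ^ e - suzukiChi e * 2 ^ ((e + 1) / 2) + 1

/-- `1 + i` has eighth power `16`. -/
lemma suz_pow8 (q : ℕ) : (⟨1, 1⟩ : GaussianInt) ^ (8 * q) = (((16 : ℤ) ^ q : ℤ) : GaussianInt) := by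
  have h : (⟨1, 1⟩ : GaussianInt) ^ 8 = ((16 : ℤ) : GaussianInt) := by decide
  rw [pow_mul, h]; push_cast; rfl

lemma suz_re (e : ℕ) (he : Odd e) :
    2 * ((⟨1, 1⟩ : GaussianInt) ^ e).re = suzukiChi e * 2 ^ ((e + 1) / 2) := by
  have key : ∀ q r s : ℕ, ∀ c : ℤ, (r + 1) / 2 = s → suzukiChi (8 * q + r) = c →
      2 * ((⟨1, 1⟩ : GaussianInt) ^ r).re = c * 2 ^ s →
      2 * ((⟨1, 1⟩ : GaussianInt) ^ (8 * q + r)).re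
        = suzukiChi (8 * q + r) * 2 ^ ((8 * q + r + 1) / 2) := by
    intro q r s c hs hc h
    have h1 : (8 * q + r + 1) / 2 = 4 * q + s := by omega
    have h2 : (2 : ℤ) ^ (4 * q) = 16 ^ q := by rw [pow_mul]; norm_num
    rw [pow_add, suz_pow8, hc, h1, pow_add, h2, Zsqrtd.re_smul]
    linear_combination 16 ^ q * h
  obtain ⟨m, rfl⟩ := he
  have h4 : m % 4 = 0 ∨ m % 4 = 1 ∨ m % 4 = 2 ∨ m % 4 = 3 := by omega
  rcases h4 with h | h | h | h
  · rw [show 2 * m + 1 = 8 * (m / 4) + 1 by omega]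
    exact key _ 1 1 1 rfl (by unfold suzukiChi; rw [if_pos]; omega) (by decide)
  · rw [show 2 * m + 1 = 8 * (m / 4) + 3 by omega]
    exact key _ 3 2 (-1) rfl (by unfold suzukiChi; rw [if_neg]; omega) (by decide)
  · rw [show 2 * m + 1 = 8 * (m / 4) + 5 by omega]
    exact key _ 5 3 (-1) rfl (by unfold suzukiChi; rw [if_neg]; omega) (by decide)
  · rw [show 2 * m + 1 = 8 * (m / 4) + 7 by omega]
    exact key _ 7 4 1 rfl (by unfold suzukiChi; rw [if_pos]; omega) (by decide)

lemma suz_norm (e : ℕ) : ((⟨1, 1⟩ : GaussianInt) ^ e).norm = 2 ^ e := by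
  have h : (⟨1, 1⟩ : GaussianInt).norm = 2 := by decide
  have := map_pow (Zsqrtd.normMonoidHom (d := -1)) (⟨1, 1⟩ : GaussianInt) e
  change ((⟨1, 1⟩ : GaussianInt) ^ e).norm = (⟨1, 1⟩ : GaussianInt).norm ^ e at this
  rw [this, h]

lemma suz_A1 (e : ℕ) (he : Odd e) :
    suzukiA1 e = ((⟨1, 1⟩ : GaussianInt) ^ e + 1).norm := by
  have h1 := suz_re e he
  have h2 := suz_norm e
  unfold suzukiA1
  rw [← h1, ← h2]
  simp only [Zsqrtd.norm_def, Zsqrtd.re_add, Zsqrtd.im_add, Zsqrtd.re_one, Zsqrtd.im_one]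
  ring

lemma suz_A2 (e : ℕ) (he : Odd e) :
    suzukiA2 e = ((⟨1, 1⟩ : GaussianInt) ^ e - 1).norm := by
  have h1 := suz_re e he
  have h2 := suz_norm e
  unfold suzukiA2
  rw [← h1, ← h2]
  simp only [Zsqrtd.norm_def, Zsqrtd.re_sub, Zsqrtd.im_sub, Zsqrtd.re_one, Zsqrtd.im_one]
  ring

lemma suz_norm_dvd {x y : GaussianInt} (h : x ∣ y) : x.norm ∣ y.norm := by
  obtain ⟨z, rfl⟩ := h
  rw [Zsqrtd.norm_mul]
  exact dvd_mul_right _ _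

/-- For odd positive integers `f ∣ e`, `a₁(f) ∣ a₁(e)` and `a₂(f) ∣ a₂(e)`. -/
theorem suzukiA_dvd (e f : ℕ) (he : Odd e) (hf : Odd f) (hepos : 0 < e) (hfpos : 0 < f)
    (hdvd : f ∣ e) :
    suzukiA1 f ∣ suzukiA1 e ∧ suzukiA2 f ∣ suzukiA2 e := by
  obtain ⟨k, rfl⟩ := hdvd
  have hk : Odd k := (Nat.odd_mul.mp he).2
  rw [suz_A1 _ he, suz_A1 _ hf, suz_A2 _ he, suz_A2 _ hf, pow_mul]
  constructor
  · apply suz_norm_dvd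
    simpa using hk.add_dvd_pow_add_pow ((⟨1, 1⟩ : GaussianInt) ^ f) 1
  · apply suz_norm_dvd
    simpa using sub_dvd_pow_sub_pow ((⟨1, 1⟩ : GaussianInt) ^ f) 1 k
end

section
/- Let e be an odd positive integer, let F = GF(2^e) be the finite field with 2^e elements, and set r = 2^{(e+1)/2}. For α, β ∈ F let M(α,β) denote the 4×4 matrix over F with rows (1,0,0,0), (α,1,0,0), (α^{r+1}+β, α^r, 1, 0), (α^{r+2}+αβ+β^r, β, α, 1). Then for all α, β, γ, δ ∈ F, M(α,β) · M(γ,δ) = M(α+γ, α·γ^r + β + δ). -/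
/-- The Suzuki matrix `(α, β)`: the lower unitriangular `4 × 4` matrix over `GF(2^e)` with
rows `(1,0,0,0)`, `(α,1,0,0)`, `(α^{r+1}+β, α^r, 1, 0)`, `(α^{r+2}+αβ+β^r, β, α, 1)`,
where `r = 2^{(e+1)/2}`. -/
noncomputable def suzukiM (e : ℕ) (α β : GaloisField 2 e) :
    Matrix (Fin 4) (Fin 4) (GaloisField 2 e) :=
  !![1, 0, 0, 0;
     α, 1, 0, 0;
     α ^ (2 ^ ((e + 1) / 2) + 1) + β, α ^ (2 ^ ((e + 1) / 2)), 1, 0;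
     α ^ (2 ^ ((e + 1) / 2) + 2) + α * β + β ^ (2 ^ ((e + 1) / 2)), β, α, 1]

/-- `M(α,β) · M(γ,δ) = M(α+γ, α·γ^r + β + δ)` over `GF(2^e)`, where `r = 2^{(e+1)/2}`. -/
theorem suzukiM_mul (e : ℕ) (he : Odd e) (hpos : 0 < e)
    (α β γ δ : GaloisField 2 e) :
    suzukiM e α β * suzukiM e γ δ =
      suzukiM e (α + γ) (α * γ ^ (2 ^ ((e + 1) / 2)) + β + δ) := by
  have h2 : (2 : GaloisField 2 e) = 0 := CharP.cast_eq_zero (GaloisField 2 e) 2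
  have hcard : ∀ x : GaloisField 2 e, x ^ (2 ^ e) = x := by
    intro x
    have : Fintype (GaloisField 2 e) := Fintype.ofFinite _
    have h := FiniteField.pow_card x
    rwa [← Nat.card_eq_fintype_card, GaloisField.card 2 e hpos.ne'] at h
  have hadd : ∀ x y : GaloisField 2 e, (x + y) ^ (2 ^ ((e + 1) / 2)) =
      x ^ (2 ^ ((e + 1) / 2)) + y ^ (2 ^ ((e + 1) / 2)) :=
    fun x y => add_pow_char_pow x y 2 _
  have hrr : ∀ x : GaloisField 2 e,
      (x ^ (2 ^ ((e + 1) / 2))) ^ (2 ^ ((e + 1) / 2)) = x ^ 2 := by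
    intro x
    have h : (e + 1) / 2 + (e + 1) / 2 = e + 1 := by
      obtain ⟨k, rfl⟩ := he
      omega
    rw [← pow_mul, ← pow_add, h, pow_succ, pow_mul, hcard]
  unfold suzukiM
  simp only [pow_add, hadd, mul_pow, hrr]
  generalize α ^ (2 ^ ((e + 1) / 2)) = a
  generalize β ^ (2 ^ ((e + 1) / 2)) = b
  generalize γ ^ (2 ^ ((e + 1) / 2)) = c
  generalize δ ^ (2 ^ ((e + 1) / 2)) = d
  ext i j
  fin_cases i <;> fin_cases j <;> simp [Matrix.mul_apply, Fin.sum_univ_four] <;>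
    first
    | ring1
    | linear_combination (-α * c) * h2
    | linear_combination (-a * γ ^ 2 - c * α ^ 2 - a * α * γ - c * α * γ) * h2
end

section
/- Let e be an odd positive integer, let F = GF(2^e), and set r = 2^{(e+1)/2}. For α, β ∈ F let M(α,β) denote the 4×4 matrix over F with rows (1,0,0,0), (α,1,0,0), (α^{r+1}+β, α^r, 1, 0), (α^{r+2}+αβ+β^r, β, α, 1). Then for all α, β ∈ F one has M(α,β)² = M(0, α^{r+1}), and consequently M(α,β)⁴ is the identity matrix. -/
/-- `M(α,β)² = M(0, α^{r+1})` over `GF(2^e)`, where `r = 2^{(e+1)/2}`; consequently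
`M(α,β)⁴` is the identity. -/
theorem suzukiM_sq (e : ℕ) (he : Odd e) (hpos : 0 < e) (α β : GaloisField 2 e) :
    suzukiM e α β ^ 2 = suzukiM e 0 (α ^ (2 ^ ((e + 1) / 2) + 1)) ∧
      suzukiM e α β ^ 4 = 1 := by
  have h2 : (2 : GaloisField 2 e) = 0 := CharTwo.two_eq_zero
  have hr : ∀ x : GaloisField 2 e, (x ^ (2 ^ ((e + 1) / 2))) ^ (2 ^ ((e + 1) / 2)) = x ^ 2 := by
    intro x
    have hF : x ^ (2 ^ e) = x := by
      have : Fintype (GaloisField 2 e) := Fintype.ofFinite _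
      have hc := GaloisField.card 2 e hpos.ne'
      rw [Nat.card_eq_fintype_card] at hc
      rw [← hc]
      exact FiniteField.pow_card x
    have h3 : (e + 1) / 2 + (e + 1) / 2 = e + 1 := by
      obtain ⟨k, rfl⟩ := he
      omega
    rw [← pow_mul, ← pow_add, h3, pow_succ, pow_mul, hF]
  have hr0 : 2 ^ ((e + 1) / 2) ≠ 0 := by positivity
  have hsq : ∀ a b : GaloisField 2 e,
      suzukiM e a b ^ 2 = suzukiM e 0 (a ^ (2 ^ ((e + 1) / 2) + 1)) := by
    intro a b
    have ha := hr a
    unfold suzukiM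
    generalize 2 ^ ((e + 1) / 2) = r at ha hr0
    have hg : (a ^ (r + 1)) ^ r = a ^ r * a ^ 2 := by
      rw [pow_succ, mul_pow, ha, mul_comm]
    rw [hg, pow_two]
    ext i j
    fin_cases i <;> fin_cases j <;>
      simp [Matrix.mul_apply, Fin.sum_univ_four, hr0] <;> grind
  refine ⟨hsq α β, ?_⟩
  have h4 : suzukiM e α β ^ 4 = (suzukiM e α β ^ 2) ^ 2 := by rw [← pow_mul]
  rw [h4, hsq, hsq]
  unfold suzukiM
  ext i j
  fin_cases i <;> fin_cases j <;> simp
end
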